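/- Let (R, 𝔪) be an excellent Noetherian local domain of prime characteristic p > 0. If 𝔭 is a prime ideal of R defining an irreducible component of the singular locus of R (i.e. 𝔭 is minimal among the prime ideals 𝔮 of R for which the localization R_𝔮 is not regular), then Tor_1^R(R^+, R/𝔭) ≠ 0. -/

import Mathlib

set_option synthInstance.maxHeartbeats 1000000
set_option maxHeartbeats 1000000
set_option linter.unusedVariables false

open CategoryTheory

/-- `Tor_n^R(M, N)`, the `n`-th Tor group of the `R`-modules `M` and `N`. -/
noncomputable abbrev TorGrp (R : Type) [CommRing R] (n : ℕ)
    (M N : Type) [AddCommGroup M] [Module R M] [AddCommGroup N] [Module R N] : Type :=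
  ((Tor (ModuleCat R) n).obj (ModuleCat.of R M)).obj (ModuleCat.of R N)

/-- The absolute integral closure `R⁺` of a domain `R`: the integral closure of `R`
in an algebraic closure of its fraction field. -/
noncomputable abbrev AbsIntClo (R : Type) [CommRing R] [IsDomain R] : Type :=
  integralClosure R (AlgebraicClosure (FractionRing R))

/-- A regular local ring: a Noetherian local ring whose maximal ideal can be generated
by Krull-dimension many elements. -/
def IsRegularLocalRingP (A : Type) [CommRing A] : Prop :=
  IsNoetherianRing A ∧ ∃ h : IsLocalRing A, ∃ s : Finset A,
    Ideal.span (s : Set A) = @IsLocalRing.maximalIdeal A _ h ∧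
      (s.card : WithBot ℕ∞) = ringKrullDim A

/-- A regular ring: a Noetherian ring all of whose localizations at primes are
regular local rings. -/
def IsRegularRingP (A : Type) [CommRing A] : Prop :=
  IsNoetherianRing A ∧
    ∀ (p : Ideal A) (hp : p.IsPrime),
      haveI := hp
      IsRegularLocalRingP (Localization.AtPrime p)

/-- A chain of primes is saturated if each step is a covering relation. -/
def IsSaturatedChain {α : Type} [Preorder α] (c : LTSeries α) : Prop :=
  ∀ i : Fin c.length, c.toFun i.castSucc ⋖ c.toFun i.succ

/-- A ring is catenary if any two saturated chains of primes with the same endpoints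
have the same length. -/
def IsCatenaryRing (A : Type) [CommRing A] : Prop :=
  ∀ c₁ c₂ : LTSeries (PrimeSpectrum A),
    c₁.head = c₂.head → c₁.last = c₂.last →
      IsSaturatedChain c₁ → IsSaturatedChain c₂ → c₁.length = c₂.length

/-- A ring is universally catenary if every finitely generated algebra over it
(i.e. every quotient of a polynomial ring over it) is catenary. -/
def IsUniversallyCatenary (A : Type) [CommRing A] : Prop :=
  ∀ (n : ℕ) (I : Ideal (MvPolynomial (Fin n) A)),
    IsCatenaryRing (MvPolynomial (Fin n) A ⧸ I)

/-- A `κ`-algebra `B` is geometrically regular if `L ⊗_κ B` is a regular ring for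
every finite field extension `L` of `κ`. -/
def IsGeometricallyRegularAlgebra (κ : Type) [Field κ] (B : Type) [CommRing B]
    [Algebra κ B] : Prop :=
  ∀ (L : Type) (_ : Field L) (_ : Algebra κ L) (_ : Module.Finite κ L),
    IsRegularRingP (TensorProduct κ L B)

/-- A ring `A` is a G-ring if for every prime `p` of `A`, all fibers of the completion
map `A_p → (A_p)^∧` are geometrically regular; the fiber at a prime `q` of `A_p` is
`κ(q) ⊗_{A_p} (A_p)^∧`. -/
def IsGRing (A : Type) [CommRing A] : Prop :=
  ∀ (p : Ideal A) (hp : p.IsPrime),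
    haveI := hp
    ∀ (q : Ideal (Localization.AtPrime p)) (hq : q.IsPrime),
      haveI := hq
      IsGeometricallyRegularAlgebra
        (IsLocalRing.ResidueField (Localization.AtPrime q))
        (TensorProduct (Localization.AtPrime p)
          (IsLocalRing.ResidueField (Localization.AtPrime q))
          (AdicCompletion (IsLocalRing.maximalIdeal (Localization.AtPrime p))
            (Localization.AtPrime p)))

/-- A ring `A` is J-2 if the regular locus of every finitely generated `A`-algebra
is open in its prime spectrum. -/
def IsJ2 (A : Type) [CommRing A] : Prop :=
  ∀ (n : ℕ) (I : Ideal (MvPolynomial (Fin n) A)),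
    IsOpen {p : PrimeSpectrum (MvPolynomial (Fin n) A ⧸ I) |
      IsRegularLocalRingP (Localization.AtPrime p.asIdeal)}

/-- A ring is excellent if it is Noetherian, universally catenary, a G-ring, and J-2. -/
def IsExcellentRing (A : Type) [CommRing A] : Prop :=
  IsNoetherianRing A ∧ IsUniversallyCatenary A ∧ IsGRing A ∧ IsJ2 A

/-- A list of elements of a local ring is a system of parameters if its elements lie in
the maximal ideal, its length is the Krull dimension, and the ideal it generates has
radical the maximal ideal (i.e. is primary to the maximal ideal). -/
def IsSystemOfParameters (R : Type) [CommRing R] [IsLocalRing R] (rs : List R) : Prop :=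
  (∀ x ∈ rs, x ∈ IsLocalRing.maximalIdeal R) ∧
    (rs.length : WithBot ℕ∞) = ringKrullDim R ∧
    (Ideal.ofList rs).radical = IsLocalRing.maximalIdeal R

/-- A local ring is Cohen-Macaulay if it is Noetherian and admits a regular sequence of
length equal to its Krull dimension consisting of elements of the maximal ideal. -/
def IsCohenMacaulayLocalRing (R : Type) [CommRing R] : Prop :=
  IsNoetherianRing R ∧ ∃ h : IsLocalRing R,
    ∃ rs : List R, (∀ x ∈ rs, x ∈ @IsLocalRing.maximalIdeal R _ h) ∧
      RingTheory.Sequence.IsRegular R rs ∧ (rs.length : WithBot ℕ∞) = ringKrullDim R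

/-- An `R`-algebra `S` is a big Cohen-Macaulay `R`-algebra if some system of parameters
of `R` is an `S`-regular sequence. -/
def IsBigCohenMacaulayAlgebra (R : Type) [CommRing R] [IsLocalRing R]
    (S : Type) [CommRing S] [Algebra R S] : Prop :=
  ∃ rs : List R, IsSystemOfParameters R rs ∧ RingTheory.Sequence.IsRegular S rs

open scoped TensorProduct in
/-- A linear form on `X ⊗ I` valued in a module killed by `I` vanishes on the kernel of
`X ⊗ I → X ⊗ R` as soon as some projective presentation of `R ⧸ I` stays exact after tensoring
with `X`. -/
theorem eq_zero_of_lTensor_exact {R : Type*} [CommRing R] (I : Ideal R)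
    {X P₀ P₁ P₂ N : Type*} [AddCommGroup X] [Module R X]
    [AddCommGroup P₀] [Module R P₀] [AddCommGroup P₁] [Module R P₁] [AddCommGroup P₂] [Module R P₂]
    [AddCommGroup N] [Module R N] [Module.Projective R P₀]
    (d₁ : P₁ →ₗ[R] P₀) (d₂ : P₂ →ₗ[R] P₁) (π : P₀ →ₗ[R] R ⧸ I)
    (hdd : d₁ ∘ₗ d₂ = 0) (hπ : Function.Surjective π) (hd : Function.Exact d₁ π)
    (hX : Function.Exact (d₂.lTensor X) (d₁.lTensor X))
    (f : X ⊗[R] I →ₗ[R] N) (hN : ∀ a ∈ I, ∀ n : N, a • n = 0)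
    (z : X ⊗[R] I) (hz : I.subtype.lTensor X z = 0) : f z = 0 := by
  obtain ⟨g, hg⟩ := Module.projective_lifting_property I.mkQ π I.mkQ_surjective
  have hgm (y : P₀) : Ideal.Quotient.mk I (g y) = π y := LinearMap.congr_fun hg y
  obtain ⟨e, he⟩ := hπ 1
  have hj (a : I) : LinearMap.toSpanSingleton R P₀ e a ∈ LinearMap.range d₁ := by
    apply (hd _).1
    rw [LinearMap.toSpanSingleton_apply, map_smul, he, Algebra.smul_def, mul_one]
    exact Ideal.Quotient.eq_zero_iff_mem.2 a.2
  have hgI (y : LinearMap.range d₁) : g y ∈ I := by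
    rw [← Ideal.Quotient.eq_zero_iff_mem, hgm]
    exact (hd _).2 y.2
  let j : I →ₗ[R] LinearMap.range d₁ :=
    ((LinearMap.toSpanSingleton R P₀ e) ∘ₗ I.subtype).codRestrict _ hj
  let r : LinearMap.range d₁ →ₗ[R] I :=
    (g ∘ₗ (LinearMap.range d₁).subtype).codRestrict I hgI
  have hrj : r ∘ₗ j = g e • LinearMap.id := by
    ext a
    change g ((a : R) • e) = g e * a
    rw [map_smul, smul_eq_mul, mul_comm]
  have hjz : j.lTensor X z = 0 := by
    obtain ⟨w, hw⟩ := LinearMap.lTensor_surjective X d₁.surjective_rangeRestrict (j.lTensor X z)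
    have hw0 : d₁.lTensor X w = 0 := by
      have h1 : d₁ = (LinearMap.range d₁).subtype ∘ₗ d₁.rangeRestrict := rfl
      have h2 : (LinearMap.range d₁).subtype ∘ₗ j =
        (LinearMap.toSpanSingleton R P₀ e) ∘ₗ I.subtype := rfl
      rw [h1, LinearMap.lTensor_comp_apply, hw, ← LinearMap.lTensor_comp_apply, h2,
        LinearMap.lTensor_comp_apply, hz, map_zero]
    obtain ⟨v, rfl⟩ := (hX w).1 hw0
    have h3 : d₁.rangeRestrict ∘ₗ d₂ = 0 := by
      ext v
      exact LinearMap.congr_fun hdd v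
    rw [← hw, ← LinearMap.lTensor_comp_apply, h3, LinearMap.lTensor_zero, LinearMap.zero_apply]
  have hez : g e • z = 0 := by
    have := congrArg (r.lTensor X) hjz
    rwa [← LinearMap.lTensor_comp_apply, hrj, map_zero, LinearMap.lTensor_smul,
      LinearMap.smul_apply, LinearMap.lTensor_id, LinearMap.id_apply] at this
  have hge : 1 - g e ∈ I := by
    rw [← Ideal.Quotient.eq_zero_iff_mem, map_sub, hgm, he, map_one, sub_self]
  have := hN _ hge (f z)
  rwa [sub_smul, one_smul, ← map_smul, hez, map_zero, sub_zero] at this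

open scoped TensorProduct in
/-- If `Tor₁ᴿ(X, R ⧸ I)` vanishes, every linear form on `X ⊗ I` valued in a module killed by `I`
vanishes on the kernel of `X ⊗ I → X ⊗ R`. -/
theorem eq_zero_of_subsingleton_torGrp {R : Type} [CommRing R] (I : Ideal R)
    {X : Type} [AddCommGroup X] [Module R X] (h : Subsingleton (TorGrp R 1 X (R ⧸ I)))
    {N : Type*} [AddCommGroup N] [Module R N]
    (f : X ⊗[R] I →ₗ[R] N) (hN : ∀ a ∈ I, ∀ n : N, a • n = 0)
    (z : X ⊗[R] I) (hz : I.subtype.lTensor X z = 0) : f z = 0 := by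
  let P := projectiveResolution (ModuleCat.of R (R ⧸ I))
  let F := (MonoidalCategory.tensoringLeft (ModuleCat R)).obj (ModuleCat.of R X)
  have h0 : Limits.IsZero ((F.leftDerived 1).obj (ModuleCat.of R (R ⧸ I))) :=
    @ModuleCat.isZero_of_subsingleton _ _ _ h
  have h1 := (HomologicalComplex.exactAt_iff_isZero_homology _ _).2
    (h0.of_iso (P.isoLeftDerivedObj F 1).symm)
  rw [HomologicalComplex.exactAt_iff' _ 2 1 0 (by simp) (by simp),
    ShortComplex.ShortExact.moduleCat_exact_iff_function_exact] at h1
  have hproj : Projective (P.complex.X 0) := inferInstance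
  have : Module.Projective R (P.complex.X 0) :=
    (IsProjective.iff_projective (R := R) (P.complex.X 0)).2 hproj
  have hπ : Function.Surjective (P.π.f 0) := (ModuleCat.epi_iff_surjective _).1 inferInstance
  have hd := (ShortComplex.ShortExact.moduleCat_exact_iff_function_exact _).1 P.exact₀
  refine eq_zero_of_lTensor_exact I (P.complex.d 1 0).hom (P.complex.d 2 1).hom (P.π.f 0).hom
    ?_ hπ hd h1 f hN z hz
  rw [← ModuleCat.hom_comp, HomologicalComplex.d_comp_d, ModuleCat.hom_zero]

section Length

variable {A : Type*} [CommRing A]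

theorem Ideal.length_quotient_anti {I J : Ideal A} (h : I ≤ J) :
    Module.length A (A ⧸ J) ≤ Module.length A (A ⧸ I) :=
  Module.length_le_of_surjective (Submodule.factor h) (Submodule.factor_surjective h)

theorem Ideal.length_quotient_eq_add (I : Ideal A) (y : A) :
    Module.length A (A ⧸ I) =
      Module.length A (A ⧸ (Submodule.comap (LinearMap.mulRight A y) I : Ideal A)) +
        Module.length A (A ⧸ I ⊔ span {y}) := by
  let f : (A ⧸ (Submodule.comap (LinearMap.mulRight A y) I : Ideal A)) →ₗ[A] A ⧸ I :=
    Submodule.mapQ _ _ (LinearMap.mulRight A y) le_rfl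
  refine Module.length_eq_add_of_exact f
    (Submodule.factor (le_sup_left : I ≤ I ⊔ span {y})) ?_ (Submodule.factor_surjective _) ?_
  · rw [← LinearMap.ker_eq_bot, Submodule.ker_mapQ, Submodule.mkQ_map_self]
  · intro z
    obtain ⟨z, rfl⟩ := Submodule.mkQ_surjective _ z
    constructor
    · intro hz
      have hz' : z ∈ I ⊔ span {y} := (Submodule.Quotient.mk_eq_zero _).1 hz
      obtain ⟨i, hi, j, hj, rfl⟩ := Submodule.mem_sup.1 hz'
      obtain ⟨c, rfl⟩ := Ideal.mem_span_singleton'.1 hj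
      exact ⟨Submodule.mkQ _ c, (Submodule.Quotient.eq _).2 (by simpa using hi)⟩
    · rintro ⟨c, hc⟩
      obtain ⟨c, rfl⟩ := Submodule.mkQ_surjective _ c
      rw [← hc]
      refine (Submodule.Quotient.mk_eq_zero _).2 (mem_sup_right ?_)
      exact Ideal.mem_span_singleton'.2 ⟨c, rfl⟩

theorem Ideal.length_quotient_sup_span_pow_le (J : Ideal A) (y : A) (q : ℕ) :
    Module.length A (A ⧸ J ⊔ span {y ^ q}) ≤ q * Module.length A (A ⧸ J ⊔ span {y}) := by
  induction q with
  | zero =>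
    have : Subsingleton (A ⧸ J ⊔ span {y ^ 0}) :=
      Ideal.Quotient.subsingleton_iff.2 (by simp [Ideal.span_singleton_one])
    simp [Module.length_eq_zero]
  | succ q ih =>
    rw [length_quotient_eq_add _ (y ^ q), Nat.cast_succ, add_mul, one_mul, add_comm]
    gcongr
    · refine (length_quotient_anti ?_).trans ih
      exact sup_le_sup_right le_sup_left _
    · refine length_quotient_anti (sup_le ?_ ?_)
      · exact fun a ha => mem_sup_left (J.mul_mem_right _ ha)
      · rw [span_singleton_le_iff_mem]
        refine mem_sup_right (mem_span_singleton'.2 ⟨1, ?_⟩)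
        simp [pow_succ']

theorem Ideal.length_quotient_sup_span_image_pow_le (T : Finset A) (J : Ideal A) (q : ℕ) :
    Module.length A (A ⧸ J ⊔ span ((· ^ q) '' (T : Set A))) ≤
      (q : ℕ∞) ^ T.card * Module.length A (A ⧸ J ⊔ span (T : Set A)) := by
  classical
  induction T using Finset.induction_on generalizing J with
  | empty =>
    rw [Finset.coe_empty, Set.image_empty, Finset.card_empty, pow_zero, one_mul]
  | insert a T ha ih =>
    rw [Finset.coe_insert, Set.image_insert_eq, span_insert, span_insert,
      Finset.card_insert_of_notMem ha, pow_succ, mul_assoc]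
    refine (length_quotient_anti (sup_assoc _ _ _).le).trans ((ih _).trans ?_)
    gcongr
    refine (length_quotient_anti (sup_right_comm _ _ _).le).trans
      ((length_quotient_sup_span_pow_le (J ⊔ span T) a q).trans ?_)
    gcongr
    refine length_quotient_anti ?_
    rw [← sup_assoc, sup_right_comm]

theorem Ideal.mul_length_quotient_colon_pow_le (J : Ideal A) (y : A) (q : ℕ)
    (hy : y ^ (q + 1) ∈ J) :
    (q + 1 : ℕ) *
        Module.length A (A ⧸ (Submodule.comap (LinearMap.mulRight A (y ^ q)) J : Ideal A)) ≤
      Module.length A (A ⧸ J) := by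
  have key : ∀ j ≤ q + 1, (j : ℕ∞) *
      Module.length A (A ⧸ (Submodule.comap (LinearMap.mulRight A (y ^ q)) J : Ideal A)) ≤
      Module.length A (A ⧸ J ⊔ span {y ^ j}) := by
    intro j
    induction j with
    | zero => simp
    | succ j ih =>
      intro hj
      rw [length_quotient_eq_add (J ⊔ span {y ^ (j + 1)}) (y ^ j), Nat.cast_succ, add_mul,
        one_mul, add_comm]
      gcongr
      · refine length_quotient_anti fun u hu => ?_
        have hu' : u * y ^ j ∈ J ⊔ span {y ^ (j + 1)} := hu
        obtain ⟨b, hb, c, hc, h⟩ := Submodule.mem_sup.1 hu'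
        obtain ⟨c, rfl⟩ := mem_span_singleton'.1 hc
        change u * y ^ q ∈ J
        obtain ⟨k, rfl⟩ : ∃ k, q = j + k := Nat.exists_eq_add_of_le (by omega)
        have : u * y ^ (j + k) = b * y ^ k + c * y ^ (j + k + 1) := by
          rw [pow_add, ← mul_assoc, ← h]
          ring
        rw [this]
        exact add_mem (J.mul_mem_right _ hb) (J.mul_mem_left _ hy)
      · refine (ih (by omega)).trans (length_quotient_anti ?_)
        refine sup_le (sup_le le_sup_left ?_) le_sup_right
        rw [span_singleton_le_iff_mem]
        exact mem_sup_right (mem_span_singleton'.2 ⟨y, by rw [pow_succ']⟩)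
  refine (key _ le_rfl).trans (length_quotient_anti le_sup_left)

theorem Ideal.pow_card_le_length_quotient {ι : Type*} (T : Finset ι) (x : ι → A) (J : Ideal A)
    (q : ℕ) (hx : ∀ i ∈ T, x i ^ (q + 1) ∈ J) (hJ : (∏ i ∈ T, x i) ^ q ∉ J) :
    ((q + 1 : ℕ) : ℕ∞) ^ T.card ≤ Module.length A (A ⧸ J) := by
  classical
  induction T using Finset.induction_on generalizing J with
  | empty =>
    have : Nontrivial (A ⧸ J) := Ideal.Quotient.nontrivial_iff.2 fun h => hJ (h ▸ trivial)
    rw [Finset.card_empty, pow_zero, Order.one_le_iff_pos]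
    exact Module.length_pos
  | insert a T ha ih =>
    rw [Finset.card_insert_of_notMem ha, pow_succ']
    refine le_trans ?_ (mul_length_quotient_colon_pow_le J (x a) q (hx a (T.mem_insert_self a)))
    gcongr
    refine ih _ (fun i hi => J.mul_mem_right _ (hx i (Finset.mem_insert_of_mem hi))) fun h => hJ ?_
    rw [Finset.prod_insert ha, mul_pow, mul_comm]
    exact h

end Length

/-- A family is Lech independent if the coefficients of its linear relations lie in the ideal it
generates. -/
def LechIndependent {ι S : Type*} [Fintype ι] [CommRing S] (f : ι → S) : Prop :=
  ∀ s : ι → S, ∑ i, s i * f i = 0 → ∀ i, s i ∈ Ideal.span (Set.range f)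

namespace LechIndependent

variable {ι S : Type*} [DecidableEq ι] [CommRing S] {f : ι → S} {a : ι} {g h : S}

theorem span_le_span_update (hgh : f a = g * h) :
    Ideal.span (Set.range f) ≤ Ideal.span (Set.range (Function.update f a g)) := by
  rw [Ideal.span_le]
  rintro _ ⟨i, rfl⟩
  by_cases hi : i = a
  · subst hi
    rw [hgh]
    exact Ideal.mul_mem_right _ _ (Ideal.subset_span ⟨i, by simp⟩)
  · exact Ideal.subset_span ⟨i, by simp [hi]⟩

variable [Fintype ι]

theorem mem_span_update (hf : LechIndependent f) (hgh : f a = g * h) {w : S}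
    (hw : h * w ∈ Ideal.span (Set.range f)) :
    w ∈ Ideal.span (Set.range (Function.update f a g)) := by
  obtain ⟨c, hc⟩ := Ideal.mem_span_range_iff_exists_fun.1 hw
  rw [← Finset.add_sum_erase _ _ (Finset.mem_univ a), hgh] at hc
  have hrel : ∑ i, Function.update (fun i => -(g * c i)) a (w - c a * g) i * f i = 0 := by
    rw [← Finset.add_sum_erase _ _ (Finset.mem_univ a), Function.update_self,
      Finset.sum_congr rfl (g := fun i => -g * (c i * f i)) fun i hi => by
        rw [Function.update_of_ne (Finset.ne_of_mem_erase hi)]; ring,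
      ← Finset.mul_sum, eq_sub_of_add_eq' hc, hgh]
    ring
  have := span_le_span_update hgh (hf _ hrel a)
  rw [Function.update_self] at this
  have hg : g ∈ Ideal.span (Set.range (Function.update f a g)) :=
    Ideal.subset_span ⟨a, by simp⟩
  simpa using add_mem this (Ideal.mul_mem_left _ (c a) hg)

theorem update (hf : LechIndependent f) (hgh : f a = g * h) :
    LechIndependent (Function.update f a g) := by
  intro s hs
  have hrel : ∑ i, Function.update (fun i => h * s i) a (s a) i * f i = 0 := by
    rw [← mul_zero h, ← hs, Finset.mul_sum]
    refine Finset.sum_congr rfl fun i _ => ?_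
    by_cases hi : i = a
    · subst hi
      simp only [Function.update_self, hgh]
      ring
    · simp only [Function.update_of_ne hi]
      ring
  intro i
  by_cases hi : i = a
  · subst hi
    simpa using span_le_span_update hgh (hf _ hrel i)
  · refine hf.mem_span_update hgh ?_
    simpa [hi] using hf _ hrel i

theorem prod_pow_notMem {y : ι → S} {q : ℕ} (hy : LechIndependent fun i => y i ^ (q + 1))
    (h1 : Ideal.span (Set.range y) ≠ ⊤) :
    (∏ i, y i) ^ q ∉ Ideal.span (Set.range fun i => y i ^ (q + 1)) := by
  intro hmem
  have key : ∀ T : Finset ι,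
      LechIndependent (T.piecewise y fun i => y i ^ (q + 1)) ∧
        (∏ i ∈ Tᶜ, y i) ^ q ∈
          Ideal.span (Set.range (T.piecewise y fun i => y i ^ (q + 1))) := by
    intro T
    induction T using Finset.induction_on with
    | empty => simpa using ⟨hy, hmem⟩
    | insert a T ha ih =>
      have hgh : T.piecewise y (fun i => y i ^ (q + 1)) a = y a * y a ^ q := by
        rw [Finset.piecewise_eq_of_notMem _ _ _ ha, pow_succ']
      rw [Finset.piecewise_insert]
      refine ⟨ih.1.update hgh, ih.1.mem_span_update hgh ?_⟩
      rw [← mul_pow, Finset.compl_insert, Finset.mul_prod_erase _ _ (Finset.mem_compl.2 ha)]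
      exact ih.2
  have := (key Finset.univ).2
  rw [Finset.compl_univ, Finset.prod_empty, one_pow, Finset.piecewise_univ,
    ← Ideal.eq_top_iff_one] at this
  exact h1 this

theorem prod_pow_notMem_of_perfectRing (p : ℕ) [ExpChar S p] [PerfectRing S p] {x : ι → S}
    (hx : LechIndependent x) (h1 : Ideal.span (Set.range x) ≠ ⊤) (e : ℕ) :
    (∏ i, x i) ^ (p ^ e - 1) ∉ Ideal.span (Set.range fun i => x i ^ p ^ e) := by
  have hq : p ^ e - 1 + 1 = p ^ e := Nat.sub_add_cancel (pow_pos (expChar_pos S p) e)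
  let φ := iterateFrobeniusEquiv S p e
  have hφ (s : S) : φ s = s ^ p ^ e := rfl
  let y : ι → S := fun i => φ.symm (x i)
  have hy (i : ι) : y i ^ p ^ e = x i := by rw [← hφ, φ.apply_symm_apply]
  have hyx : (fun i => y i ^ (p ^ e - 1 + 1)) = x := by
    funext i
    rw [hq, hy]
  have hspan : Ideal.span (Set.range y) ≠ ⊤ := by
    intro h
    apply h1
    rw [Ideal.eq_top_iff_one, Ideal.mem_span_range_iff_exists_fun] at h ⊢
    obtain ⟨c, hc⟩ := h
    refine ⟨fun i => φ (c i), ?_⟩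
    rw [← map_one φ, ← hc, map_sum]
    exact Finset.sum_congr rfl fun i _ => by rw [map_mul, φ.apply_symm_apply]
  have := prod_pow_notMem (q := p ^ e - 1) (hyx ▸ hx) hspan
  rw [hyx] at this
  refine fun hmem => this ?_
  obtain ⟨c, hc⟩ := Ideal.mem_span_range_iff_exists_fun.1 hmem
  refine Ideal.mem_span_range_iff_exists_fun.2 ⟨fun i => φ.symm (c i), φ.injective ?_⟩
  rw [map_sum, map_pow, map_prod]
  simp only [map_mul, y, φ.apply_symm_apply]
  rw [← hc]
  rfl

end LechIndependent

/-- If the generators of the maximal ideal of a Noetherian local ring of characteristic `p` become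
Lech independent in some perfect algebra in which they do not generate the unit ideal, then their
number is at most the Krull dimension. -/
theorem LechIndependent.card_le_ringKrullDim {A : Type*} [CommRing A] [IsNoetherianRing A]
    [IsLocalRing A] (p : ℕ) [Fact p.Prime] [CharP A p] {S : Type*} [CommRing S] [Algebra A S]
    [CharP S p] [PerfectRing S p] {ι : Type*} [Fintype ι] (x : ι → A)
    (hx : Ideal.span (Set.range x) = IsLocalRing.maximalIdeal A)
    (hS : LechIndependent fun i => algebraMap A S (x i))
    (h1 : Ideal.span (Set.range fun i => algebraMap A S (x i)) ≠ ⊤) :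
    (Fintype.card ι : WithBot ℕ∞) ≤ ringKrullDim A := by
  classical
  have hp : p.Prime := Fact.out
  obtain ⟨T, hT, hcard⟩ :=
    (IsLocalRing.maximalIdeal A).exists_finset_card_eq_height_of_isNoetherianRing
  rw [← IsLocalRing.maximalIdeal_height_eq_ringKrullDim, ← hcard]
  suffices Fintype.card ι ≤ T.card by exact_mod_cast this
  have hC : Module.length A (A ⧸ (⊥ ⊔ Ideal.span (T : Set A))) ≠ ⊤ := by
    rw [← bot_sup_eq (Ideal.span (T : Set A))] at hT
    have := IsLocalRing.quotient_artinian_of_mem_minimalPrimes_of_isLocalRing _ hT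
    have : IsArtinian A (A ⧸ (⊥ ⊔ Ideal.span (T : Set A))) :=
      isArtinian_of_surjective_algebraMap (R := A ⧸ (⊥ ⊔ Ideal.span (T : Set A)))
        Ideal.Quotient.mk_surjective
    exact Module.length_ne_top
  obtain ⟨C, hC⟩ := ENat.ne_top_iff_exists.1 hC
  have key (e : ℕ) : (p ^ e) ^ Fintype.card ι ≤ (p ^ e) ^ T.card * C := by
    have hq : p ^ e - 1 + 1 = p ^ e := Nat.sub_add_cancel (pow_pos hp.pos e)
    have hle : ⊥ ⊔ Ideal.span ((· ^ p ^ e) '' (T : Set A)) ≤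
        Ideal.span (Set.range fun i => x i ^ p ^ e) := by
      rw [bot_sup_eq, Ideal.span_le]
      rintro _ ⟨t, ht, rfl⟩
      have htm : t ∈ Ideal.span (Set.range x) := hx ▸ hT.1.2 (Ideal.subset_span ht)
      obtain ⟨c, rfl⟩ := Ideal.mem_span_range_iff_exists_fun.1 htm
      refine Ideal.mem_span_range_iff_exists_fun.2 ⟨fun i => c i ^ p ^ e, ?_⟩
      simp only [sum_pow_char_pow, mul_pow]
    have hlow := Ideal.pow_card_le_length_quotient Finset.univ x
      (Ideal.span (Set.range fun i => x i ^ p ^ e)) (p ^ e - 1)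
      (fun i _ => by rw [hq]; exact Ideal.subset_span ⟨i, rfl⟩) (fun hmem => by
        refine hS.prod_pow_notMem_of_perfectRing p h1 e ?_
        have := Ideal.mem_map_of_mem (algebraMap A S) hmem
        rw [Ideal.map_span, ← Set.range_comp] at this
        simpa [Function.comp_def] using this)
    have := hlow.trans ((Ideal.length_quotient_anti hle).trans
      (Ideal.length_quotient_sup_span_image_pow_le T ⊥ (p ^ e)))
    rw [hq, ← hC, Finset.card_univ] at this
    exact_mod_cast this
  by_contra! hlt
  have h := key C
  obtain ⟨k, hk⟩ := Nat.exists_eq_add_of_lt hlt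
  rw [hk, add_assoc, pow_add] at h
  have h2 := Nat.le_of_mul_le_mul_left h (pow_pos (pow_pos hp.pos C) _)
  have h3 : p ^ C ≤ (p ^ C) ^ (k + 1) := Nat.le_self_pow (Nat.succ_ne_zero k) _
  exact absurd (h3.trans h2) (not_le.2 (Nat.lt_pow_self hp.one_lt))

theorem IsRegularLocalRingP.of_lechIndependent {A : Type} [CommRing A] [IsNoetherianRing A]
    [IsLocalRing A] (p : ℕ) [Fact p.Prime] [CharP A p] {S : Type*} [CommRing S] [Algebra A S]
    [CharP S p] [PerfectRing S p] {ι : Type*} [Fintype ι] (x : ι → A)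
    (hx : Ideal.span (Set.range x) = IsLocalRing.maximalIdeal A)
    (hS : LechIndependent fun i => algebraMap A S (x i))
    (h1 : Ideal.span (Set.range fun i => algebraMap A S (x i)) ≠ ⊤) :
    IsRegularLocalRingP A := by
  classical
  have hspan : Ideal.span ((Finset.univ.image x : Finset A) : Set A) =
      IsLocalRing.maximalIdeal A := by
    rw [Finset.coe_image, Finset.coe_univ, Set.image_univ, hx]
  refine ⟨‹_›, ‹_›, Finset.univ.image x, hspan, le_antisymm ?_ ?_⟩
  · refine le_trans ?_ (LechIndependent.card_le_ringKrullDim p x hx hS h1)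
    exact_mod_cast Finset.card_image_le
  · rw [← IsLocalRing.maximalIdeal_height_eq_ringKrullDim]
    have := Ideal.height_le_card_of_mem_minimalPrimes_span_finset
      (p := IsLocalRing.maximalIdeal A) (s := Finset.univ.image x)
      (by rw [hspan, Ideal.minimalPrimes_eq_subsingleton_self]; rfl)
    exact_mod_cast this

theorem IsLocalization.perfectRing {B : Type*} [CommRing B] (p : ℕ) [ExpChar B p]
    [PerfectRing B p] (M : Submonoid B) (S : Type*) [CommRing S] [Algebra B S]
    [IsLocalization M S] [ExpChar S p] [IsReduced S] : PerfectRing S p := by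
  refine PerfectRing.ofSurjective S p fun s => ?_
  obtain ⟨b, m, rfl⟩ := IsLocalization.exists_mk'_eq M s
  obtain ⟨c, hc⟩ := surjective_frobenius B p (b * (m : B) ^ (p - 1))
  refine ⟨IsLocalization.mk' S c m, ?_⟩
  have hp : p - 1 + 1 = p := Nat.sub_add_cancel (expChar_pos B p)
  rw [frobenius_def] at hc ⊢
  rw [← IsLocalization.mk'_pow, IsLocalization.mk'_eq_iff_eq, hc]
  congr 1
  rw [SubmonoidClass.coe_pow]
  calc (m : B) * (b * (m : B) ^ (p - 1)) = (m : B) ^ (p - 1 + 1) * b := by ring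
    _ = _ := by rw [hp]

theorem perfectRing_absIntClo (R : Type) [CommRing R] [IsDomain R] (p : ℕ) [Fact p.Prime]
    [CharP (AbsIntClo R) p] : PerfectRing (AbsIntClo R) p := by
  refine PerfectRing.ofSurjective _ p fun x => ?_
  have hp : p.Prime := Fact.out
  obtain ⟨z, hz⟩ := IsAlgClosed.exists_pow_nat_eq (x : AlgebraicClosure (FractionRing R)) hp.pos
  exact ⟨⟨z, .of_pow hp.pos (hz ▸ x.2)⟩, Subtype.ext hz⟩

section Localization

variable {R : Type*} [CommRing R] (P : Ideal R) [P.IsPrime] (A : Type*) [CommRing A] [Algebra R A]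
  [IsLocalization.AtPrime A P] [IsLocalRing A]

/-- The inclusion of a prime ideal in the maximal ideal of the localization. -/
def IsLocalization.AtPrime.toMaximalIdeal : P →ₗ[R] IsLocalRing.maximalIdeal A where
  toFun a := ⟨algebraMap R A a, (IsLocalization.AtPrime.to_map_mem_maximal_iff A P a).2 a.2⟩
  map_add' a b := Subtype.ext (map_add _ _ _)
  map_smul' r a := Subtype.ext <| by simp [Algebra.smul_def]

theorem IsLocalization.AtPrime.span_toCotangent :
    Submodule.span (IsLocalRing.ResidueField A) (Set.range fun a : P =>
      (IsLocalRing.maximalIdeal A).toCotangent (toMaximalIdeal P A a)) = ⊤ := by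
  rw [eq_top_iff]
  rintro v -
  obtain ⟨z, rfl⟩ := Ideal.toCotangent_surjective _ v
  obtain ⟨a, s, hz⟩ := IsLocalization.exists_mk'_eq P.primeCompl (z : A)
  have ha : a ∈ P := by
    rw [← IsLocalization.AtPrime.to_map_mem_maximal_iff A P, ← IsLocalization.mk'_spec A a s, hz]
    exact Ideal.mul_mem_right _ _ z.2
  have hz' : z = IsLocalization.mk' A 1 s • toMaximalIdeal P A ⟨a, ha⟩ := by
    refine Subtype.ext ?_
    change (z : A) = IsLocalization.mk' A 1 s * algebraMap R A a
    rw [← hz, mul_comm, IsLocalization.mul_mk'_eq_mk'_of_mul, mul_one]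
  rw [hz', map_smul]
  exact Submodule.smul_of_tower_mem _ _ (Submodule.subset_span ⟨_, rfl⟩)

/-- The maximal ideal of the localization at `P` is generated by finitely many elements of `P`
forming a basis of the cotangent space. -/
theorem IsLocalization.AtPrime.exists_basis_cotangentSpace [IsNoetherianRing A] :
    ∃ (n : ℕ) (a : Fin n → P)
      (b : Module.Basis (Fin n) (IsLocalRing.ResidueField A) (IsLocalRing.CotangentSpace A)),
      (∀ i, b i = (IsLocalRing.maximalIdeal A).toCotangent (toMaximalIdeal P A (a i))) ∧
      Ideal.span (Set.range fun i => algebraMap R A (a i)) = IsLocalRing.maximalIdeal A := by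
  obtain ⟨κ, a, -, hspan, hli⟩ := exists_linearIndependent' (IsLocalRing.ResidueField A)
    fun a : P => (IsLocalRing.maximalIdeal A).toCotangent (toMaximalIdeal P A a)
  have : Finite κ := hli.finite
  obtain ⟨n, ⟨e⟩⟩ := Finite.exists_equiv_fin κ
  rw [span_toCotangent] at hspan
  let b := (Module.Basis.mk hli hspan.ge).reindex e
  have hb (i : Fin n) :
      b i = (IsLocalRing.maximalIdeal A).toCotangent (toMaximalIdeal P A (a (e.symm i))) := by
    simp [b]
  refine ⟨n, a ∘ e.symm, b, hb, ?_⟩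
  have h := b.span_eq
  rw [show ⇑b = (IsLocalRing.maximalIdeal A).toCotangent ∘
    fun i => toMaximalIdeal P A (a (e.symm i)) from funext hb, Set.range_comp,
    IsLocalRing.CotangentSpace.span_image_eq_top_iff] at h
  have := congrArg (Submodule.map (IsLocalRing.maximalIdeal A).subtype) h
  rw [Submodule.map_span, ← Set.range_comp, Submodule.map_top, Submodule.range_subtype] at this
  exact this

variable {B : Type*} [CommRing B] [Algebra R B] (S : Type*) [CommRing S] [Algebra B S]
  [Algebra A S] [Algebra R S] [IsScalarTower R B S] [IsScalarTower R A S]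

/-- A linear form on the cotangent space of the localization at `P`, read on `B ⊗ P` with values in
the fibre of `S` over the closed point. -/
noncomputable def cotangentForm
    (φ : IsLocalRing.CotangentSpace A →ₗ[IsLocalRing.ResidueField A] IsLocalRing.ResidueField A) :
    TensorProduct R B P →ₗ[R] S ⧸ (IsLocalRing.maximalIdeal A).map (algebraMap A S) :=
  let J := (IsLocalRing.maximalIdeal A).map (algebraMap A S)
  let ψ : IsLocalRing.ResidueField A →ₗ[A] S ⧸ J :=
    Submodule.mapQ (IsLocalRing.maximalIdeal A) (J.restrictScalars A) (Algebra.linearMap A S)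
      fun _ ha => Ideal.mem_map_of_mem _ ha
  LinearMap.mul' R (S ⧸ J) ∘ₗ TensorProduct.map
    ((Ideal.Quotient.mkₐ R J).toLinearMap ∘ₗ (IsScalarTower.toAlgHom R B S).toLinearMap)
    ((ψ ∘ₗ φ.restrictScalars A ∘ₗ (IsLocalRing.maximalIdeal A).toCotangent).restrictScalars R ∘ₗ
      IsLocalization.AtPrime.toMaximalIdeal P A)

theorem cotangentForm_tmul
    (φ : IsLocalRing.CotangentSpace A →ₗ[IsLocalRing.ResidueField A] IsLocalRing.ResidueField A)
    (t : B) (a : P) (c : A) (hc : φ ((IsLocalRing.maximalIdeal A).toCotangent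
      (IsLocalization.AtPrime.toMaximalIdeal P A a)) = IsLocalRing.residue A c) :
    cotangentForm P A S φ (t ⊗ₜ[R] a) =
      Ideal.Quotient.mk _ (algebraMap B S t * algebraMap A S c) := by
  rw [map_mul]
  refine congrArg (Ideal.Quotient.mk _ (algebraMap B S t) * ·) ?_
  exact congrArg (Submodule.mapQ (IsLocalRing.maximalIdeal A)
    (((IsLocalRing.maximalIdeal A).map (algebraMap A S)).restrictScalars A) (Algebra.linearMap A S)
      fun _ ha => Ideal.mem_map_of_mem _ ha) hc

end Localization

/-- If `Tor₁ᴿ(B, R ⧸ P)` vanishes, generators of `P R_P` in `P` that form a basis of the cotangent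
space of `R_P` become Lech independent in the localization of `B` at `P`. -/
theorem lechIndependent_of_subsingleton_torGrp {R : Type} [CommRing R] (P : Ideal R) [P.IsPrime]
    {A : Type} [CommRing A] [Algebra R A] [IsLocalization.AtPrime A P] [IsLocalRing A]
    {B : Type} [CommRing B] [Algebra R B]
    {S : Type} [CommRing S] [Algebra B S] [Algebra A S] [Algebra R S] [IsScalarTower R B S]
    [IsScalarTower R A S] [IsLocalization (Algebra.algebraMapSubmonoid B P.primeCompl) S]
    (hBS : Function.Injective (algebraMap B S))
    (hTor : Subsingleton (TorGrp R 1 B (R ⧸ P))) {n : ℕ} (a : Fin n → P)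
    (b : Module.Basis (Fin n) (IsLocalRing.ResidueField A) (IsLocalRing.CotangentSpace A))
    (hb : ∀ i, b i = (IsLocalRing.maximalIdeal A).toCotangent
      (IsLocalization.AtPrime.toMaximalIdeal P A (a i)))
    (ha : Ideal.span (Set.range fun i => algebraMap R A (a i)) = IsLocalRing.maximalIdeal A) :
    LechIndependent fun i => algebraMap A S (algebraMap R A (a i)) := by
  intro s hs i
  have hspan : Ideal.span (Set.range fun i => algebraMap A S (algebraMap R A (a i))) =
      (IsLocalRing.maximalIdeal A).map (algebraMap A S) := by
    rw [← ha, Ideal.map_span, ← Set.range_comp]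
    rfl
  rw [hspan]
  obtain ⟨d, hd⟩ := IsLocalization.exist_integer_multiples_of_finite
    (Algebra.algebraMapSubmonoid B P.primeCompl) s
  choose t ht using hd
  have hmap (j : Fin n) : algebraMap B S (algebraMap R B (a j)) =
      algebraMap A S (algebraMap R A (a j)) := by
    rw [← IsScalarTower.algebraMap_apply, ← IsScalarTower.algebraMap_apply]
  have hsum : ∑ j, t j * algebraMap R B (a j) = 0 := by
    apply hBS
    simp only [map_sum, map_mul, hmap, ht, map_zero, smul_mul_assoc, ← Finset.smul_sum, hs,
      smul_zero]
  have hz : P.subtype.lTensor B (∑ j, t j ⊗ₜ[R] a j) = 0 := by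
    apply (TensorProduct.rid R B).injective
    rw [map_zero, ← hsum]
    simp [Algebra.smul_def, mul_comm]
  have hN (r : R) (hr : r ∈ P) (v : S ⧸ (IsLocalRing.maximalIdeal A).map (algebraMap A S)) :
      r • v = 0 := by
    obtain ⟨v, rfl⟩ := Ideal.Quotient.mk_surjective v
    rw [← Ideal.Quotient.mkₐ_eq_mk R, ← map_smul, Ideal.Quotient.mkₐ_eq_mk,
      Ideal.Quotient.eq_zero_iff_mem, Algebra.smul_def, IsScalarTower.algebraMap_apply R A S]
    exact Ideal.mul_mem_right _ _ <| Ideal.mem_map_of_mem _ <|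
      (IsLocalization.AtPrime.to_map_mem_maximal_iff A P r).2 hr
  have h0 := eq_zero_of_subsingleton_torGrp P hTor (cotangentForm P A S (b.coord i)) hN _ hz
  have hform (j : Fin n) : cotangentForm P A S (b.coord i) (t j ⊗ₜ[R] a j) =
      Ideal.Quotient.mk _ (algebraMap B S (t j) * algebraMap A S (if j = i then 1 else 0)) := by
    apply cotangentForm_tmul
    rw [← hb, Module.Basis.coord_apply, Module.Basis.repr_self, Finsupp.single_apply]
    split_ifs <;> simp
  have hti : algebraMap B S (t i) ∈ (IsLocalRing.maximalIdeal A).map (algebraMap A S) := by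
    rw [← Ideal.Quotient.eq_zero_iff_mem, ← h0, map_sum]
    simp only [hform]
    rw [Finset.sum_eq_single i (fun j _ hj => by simp [hj]) (by simp)]
    simp
  rw [ht, Algebra.smul_def] at hti
  exact (Ideal.unit_mul_mem_iff_mem _ (IsLocalization.map_units S d)).1 hti

/-- Let `(R, 𝔪)` be an excellent local domain of prime characteristic `p`. If `𝔭` is a
prime defining an irreducible component of the singular locus of `R` (i.e. `𝔭` is
minimal among primes `q` with `R_q` not regular), then `Tor_1^R(R⁺, R/𝔭) ≠ 0`. -/
theorem tor_one_nonzero_at_component_of_singular_locus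
    (R : Type) [CommRing R] [IsDomain R] [IsNoetherianRing R] [IsLocalRing R]
    (hExc : IsExcellentRing R)
    (p : ℕ) (hp : p.Prime) [CharP R p]
    (𝔭 : Ideal R) (h𝔭 : 𝔭.IsPrime)
    (hsing : ¬ (haveI := h𝔭; IsRegularLocalRingP (Localization.AtPrime 𝔭)))
    (hmin : ∀ (q : Ideal R) (hq : q.IsPrime),
      ¬ (haveI := hq; IsRegularLocalRingP (Localization.AtPrime q)) → q ≤ 𝔭 → q = 𝔭) :
    ¬ Subsingleton (TorGrp R 1 (AbsIntClo R) (R ⧸ 𝔭)) := by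
  intro hTor
  have : Fact p.Prime := ⟨hp⟩
  let B := AbsIntClo R
  let A := Localization.AtPrime 𝔭
  let M := Algebra.algebraMapSubmonoid B 𝔭.primeCompl
  let S := Localization M
  have hRB : Function.Injective (algebraMap R B) :=
    have h : Function.Injective (algebraMap R (AlgebraicClosure (FractionRing R))) := by
      rw [IsScalarTower.algebraMap_eq R (FractionRing R)]
      exact (algebraMap (FractionRing R) _).injective.comp (IsFractionRing.injective R _)
    fun x y hxy => h (congrArg Subtype.val hxy)
  have hM : M ≤ nonZeroDivisors B := by
    rintro _ ⟨r, hr, rfl⟩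
    refine mem_nonZeroDivisors_of_ne_zero fun h => hr ?_
    rw [(map_eq_zero_iff _ hRB).1 h]
    exact 𝔭.zero_mem
  have hBS : Function.Injective (algebraMap B S) := IsLocalization.injective S hM
  have : IsDomain S := IsLocalization.isDomain_localization hM
  have hRA : Function.Injective (algebraMap R A) :=
    IsLocalization.injective A 𝔭.primeCompl_le_nonZeroDivisors
  have : CharP A p := charP_of_injective_algebraMap hRA p
  have : CharP B p := charP_of_injective_algebraMap hRB p
  have : CharP S p := charP_of_injective_algebraMap hBS p
  have : PerfectRing B p := perfectRing_absIntClo R p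
  have : PerfectRing S p := IsLocalization.perfectRing p M S
  obtain ⟨n, a, b, hb, ha⟩ := IsLocalization.AtPrime.exists_basis_cotangentSpace 𝔭 A
  refine hsing (IsRegularLocalRingP.of_lechIndependent p _ ha
    (lechIndependent_of_subsingleton_torGrp 𝔭 (S := S) hBS hTor a b hb ha) ?_)
  have hAS : Function.Injective (algebraMap A S) :=
    localizationAlgebra_injective (M := 𝔭.primeCompl) A S hRB
  have hint : (algebraMap A S).IsIntegral := isIntegral_localization (M := 𝔭.primeCompl)
  rw [← Function.comp_def, Set.range_comp, ← Ideal.map_span, ha, Ne,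
    Ideal.map_eq_top_iff _ hAS hint]
  exact Ideal.IsPrime.ne_top'
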